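/- arXiv:1502.05843 — 6 statements merged into one kernel-verified Lean document; each statement's English description precedes it below -/
import Mathlib

section
/- Let H : ℝ → ℝ be three times continuously differentiable, let x₊ ∈ ℝ with b := H''(x₊) > 0 and σ₀ := H'(x₊), let a < 0, 0 < δ < −a/2, M > 0 and T ∈ ℝ, and let φ : (−∞,T] → ℝ be continuous with |φ(t)| ≤ M·e^{−(2a+δ)t} for all t ≤ T. Then there exists t₀ ≤ T such that there is exactly one continuous function Y : (−∞,t₀] → ℝ satisfying |Y(t)| ≤ e^{(−a+δ)t} for all t ≤ t₀ and the integral equation Y(t) = ∫_{−∞}^t e^{−b(t−s)}·(φ(s) − ρ₊(s)) ds for all t ≤ t₀, where ρ₊(s) := H'(x₊ + Y(s)) − σ₀ − b·Y(s). Consequently X₊ := x₊ + Y is differentiable on (−∞,t₀], solves X₊'(t) = −(H'(X₊(t)) − (σ₀ + φ(t))), and X₊(t) − x₊ → 0 as t → −∞. -/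
open Set Filter MeasureTheory Topology

/-- The integral-equation formulation of the stable characteristic: `Y` is continuous on
`(-∞, t₀]`, satisfies the decay bound `|Y t| ≤ e^{(-a+δ)t}`, and solves the fixed point
equation `Y t = ∫_{-∞}^t e^{-b(t-s)} (φ s - ρ₊ s) ds`, where
`ρ₊ s = H'(x₊ + Y s) - σ₀ - b·Y s` with `σ₀ = H'(x₊)` and `b = H''(x₊)`. -/
def IntEqPlus (H : ℝ → ℝ) (xp a δ b : ℝ) (φ Y : ℝ → ℝ) (t₀ : ℝ) : Prop :=
  ContinuousOn Y (Set.Iic t₀) ∧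
  (∀ t ≤ t₀, |Y t| ≤ Real.exp ((-a + δ) * t)) ∧
  (∀ t ≤ t₀, Y t = ∫ s in Set.Iic t, Real.exp (-b * (t - s)) *
      (φ s - (deriv H (xp + Y s) - deriv H xp - b * Y s)))

/-- The convolution `t ↦ ∫_{-∞}^t e^{-b(t-s)} h s ds` with a one-sided exponential kernel. -/
noncomputable def expConv (b : ℝ) (h : ℝ → ℝ) (t : ℝ) : ℝ :=
  ∫ s in Iic t, Real.exp (-b * (t - s)) * h s

theorem expConv_congr {b t : ℝ} {h k : ℝ → ℝ} (hk : ∀ s ≤ t, h s = k s) :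
    expConv b h t = expConv b k t :=
  setIntegral_congr_fun measurableSet_Iic fun s hs => by simp only [hk s hs]

theorem expConv_eq (b : ℝ) (h : ℝ → ℝ) (t : ℝ) :
    expConv b h t = Real.exp (-b * t) * ∫ s in Iic t, Real.exp (b * s) * h s := by
  rw [expConv, ← integral_const_mul]
  congr 1 with s
  rw [← mul_assoc, ← Real.exp_add]
  ring_nf

theorem integrableOn_exp_mul_of_bounded {b C t : ℝ} (hb : 0 < b) {h : ℝ → ℝ} (hc : Continuous h)
    (hC : ∀ s, |h s| ≤ C) : IntegrableOn (fun s => Real.exp (b * s) * h s) (Iic t) :=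
  (integrableOn_exp_mul_Iic hb t).mul_bdd hc.aestronglyMeasurable
    (Eventually.of_forall hC)

theorem expConv_sub {b C D : ℝ} (hb : 0 < b) {h k : ℝ → ℝ} (hc : Continuous h)
    (hC : ∀ s, |h s| ≤ C) (kc : Continuous k) (kD : ∀ s, |k s| ≤ D) (t : ℝ) :
    expConv b h t - expConv b k t = expConv b (fun s => h s - k s) t := by
  simp only [expConv_eq, mul_sub]
  rw [integral_sub (integrableOn_exp_mul_of_bounded hb hc hC)
    (integrableOn_exp_mul_of_bounded hb kc kD), mul_sub]

theorem abs_expConv_le {b C t : ℝ} (hb : 0 < b) {h : ℝ → ℝ} (hC : ∀ s ≤ t, |h s| ≤ C) :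
    |expConv b h t| ≤ C / b := by
  have key : |∫ s in Iic t, Real.exp (b * s) * h s| ≤ ∫ s in Iic t, Real.exp (b * s) * C := by
    rw [← Real.norm_eq_abs]
    refine norm_integral_le_of_norm_le ((integrableOn_exp_mul_Iic hb t).mul_const C) ?_
    refine (ae_restrict_iff' measurableSet_Iic).2 (Eventually.of_forall fun s hs => ?_)
    rw [Real.norm_eq_abs, abs_mul, Real.abs_exp]
    exact mul_le_mul_of_nonneg_left (hC s hs) (Real.exp_pos _).le
  rw [integral_mul_const, integral_exp_mul_Iic hb] at key
  rw [expConv_eq, abs_mul, Real.abs_exp]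
  refine (mul_le_mul_of_nonneg_left key (Real.exp_pos _).le).trans (le_of_eq ?_)
  rw [show Real.exp (-b * t) * (Real.exp (b * t) / b * C)
    = Real.exp (-b * t) * Real.exp (b * t) * (C / b) by ring, ← Real.exp_add]
  simp

theorem hasDerivAt_expConv {b C : ℝ} (hb : 0 < b) {h : ℝ → ℝ} (hc : Continuous h)
    (hC : ∀ s, |h s| ≤ C) (t : ℝ) :
    HasDerivAt (expConv b h) (h t - b * expConv b h t) t := by
  have hint := fun t => integrableOn_exp_mul_of_bounded (t := t) hb hc hC
  have hF : HasDerivAt (fun u => ∫ s in Iic u, Real.exp (b * s) * h s)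
      (Real.exp (b * t) * h t) t := by
    have h1 : Continuous fun s => Real.exp (b * s) * h s := by fun_prop
    have h2 := (h1.integral_hasStrictDerivAt 0 t).hasDerivAt.const_add
      (∫ s in Iic 0, Real.exp (b * s) * h s)
    refine h2.congr_of_eventuallyEq (Eventually.of_forall fun u => ?_)
    simp only [← intervalIntegral.integral_Iic_sub_Iic (hint 0) (hint u), add_sub_cancel]
  have hE : HasDerivAt (fun u => Real.exp (-b * u)) (Real.exp (-b * t) * (-b * 1)) t :=
    ((hasDerivAt_id t).const_mul (-b)).exp
  have hfun : expConv b h = fun u => Real.exp (-b * u) * ∫ s in Iic u, Real.exp (b * s) * h s :=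
    funext (expConv_eq b h)
  have hprod := hE.mul hF
  rw [hfun]
  refine hprod.congr_deriv ?_
  have : Real.exp (-b * t) * Real.exp (b * t) = 1 := by rw [← Real.exp_add]; simp
  linear_combination h t * this

theorem continuous_expConv {b C : ℝ} (hb : 0 < b) {h : ℝ → ℝ} (hc : Continuous h)
    (hC : ∀ s, |h s| ≤ C) : Continuous (expConv b h) :=
  continuous_iff_continuousAt.2 fun t => (hasDerivAt_expConv hb hc hC t).continuousAt

/-- If every bound `C` for `|D|` on `(-∞, t]` improves to `A + C / 2`, then `2 * A` is a bound. -/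
theorem abs_le_of_bound_improves {D : ℝ → ℝ} {t A C₀ : ℝ} (h0 : ∀ s ≤ t, |D s| ≤ C₀)
    (h : ∀ C, (∀ s ≤ t, |D s| ≤ C) → ∀ s ≤ t, |D s| ≤ A + C / 2) : |D t| ≤ 2 * A := by
  set S := (fun s => |D s|) '' Iic t with hS
  have hne : S.Nonempty := ⟨_, t, self_mem_Iic, rfl⟩
  have hbdd : BddAbove S := ⟨C₀, by rintro _ ⟨s, hs, rfl⟩; exact h0 s hs⟩
  have hle : ∀ s ≤ t, |D s| ≤ sSup S := fun s hs => le_csSup hbdd ⟨s, hs, rfl⟩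
  have : sSup S ≤ A + sSup S / 2 := csSup_le hne (by rintro _ ⟨s, hs, rfl⟩; exact h _ hle s hs)
  linarith [hle t le_rfl]

theorem continuous_of_abs_sub_le {K : ℝ} (hK : 0 ≤ K) {ρ : ℝ → ℝ}
    (hρ : ∀ y z, |ρ y - ρ z| ≤ K * |y - z|) : Continuous ρ :=
  (LipschitzWith.of_dist_le_mul (f := ρ) (K := ⟨K, hK⟩) hρ).continuous

theorem exists_eq_expConv {b K : ℝ} (hb : 0 < b) {φ ρ : ℝ → ℝ} (hφ : Continuous φ)
    (hK : ∀ s, |φ s| ≤ K) (hρ0 : ρ 0 = 0) (hρ : ∀ y z, |ρ y - ρ z| ≤ b / 2 * |y - z|) :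
    ∃ Y : BoundedContinuousFunction ℝ ℝ, ∀ t, Y t = expConv b (fun s => φ s - ρ (Y s)) t := by
  have hρc : Continuous ρ := continuous_of_abs_sub_le (by positivity) hρ
  have hc : ∀ Y : BoundedContinuousFunction ℝ ℝ, Continuous fun s => φ s - ρ (Y s) := fun Y => by
    fun_prop
  have hbd : ∀ (Y : BoundedContinuousFunction ℝ ℝ) s, |φ s - ρ (Y s)| ≤ K + b / 2 * ‖Y‖ := by
    intro Y s
    have h1 := hρ (Y s) 0
    rw [hρ0, sub_zero, sub_zero] at h1
    have h2 : b / 2 * |Y s| ≤ b / 2 * ‖Y‖ :=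
      mul_le_mul_of_nonneg_left (Y.norm_coe_le_norm s) (by positivity)
    linarith [abs_sub (φ s) (ρ (Y s)), hK s]
  let G : BoundedContinuousFunction ℝ ℝ → BoundedContinuousFunction ℝ ℝ := fun Y =>
    BoundedContinuousFunction.ofNormedAddCommGroup (expConv b fun s => φ s - ρ (Y s))
      (continuous_expConv hb (hc Y) (hbd Y)) ((K + b / 2 * ‖Y‖) / b)
      fun t => abs_expConv_le hb fun s _ => hbd Y s
  have hG : ContractingWith (1 / 2) G := by
    refine ⟨by norm_num, LipschitzWith.of_dist_le_mul fun Y Z => ?_⟩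
    refine (BoundedContinuousFunction.dist_le (by positivity)).2 fun t => ?_
    rw [Real.dist_eq]
    change |expConv b _ t - expConv b _ t| ≤ _
    rw [expConv_sub hb (hc Y) (hbd Y) (hc Z) (hbd Z)]
    refine (abs_expConv_le (C := b / 2 * dist Y Z) hb fun s _ => ?_).trans (le_of_eq ?_)
    · rw [show φ s - ρ (Y s) - (φ s - ρ (Z s)) = -(ρ (Y s) - ρ (Z s)) by ring, abs_neg]
      refine (hρ _ _).trans (mul_le_mul_of_nonneg_left ?_ (by positivity))
      exact BoundedContinuousFunction.dist_coe_le_dist (f := Y) (g := Z) s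
    · push_cast
      field_simp
  refine ⟨hG.fixedPoint, fun t => ?_⟩
  exact (DFunLike.congr_fun hG.fixedPoint_isFixedPt t).symm

/-- The linearization remainder of `f` at `x` has arbitrarily small Lipschitz constant near `0`. -/
theorem exists_remainder_lipschitz {f : ℝ → ℝ} {x b ε : ℝ} (hf : HasStrictDerivAt f b x)
    (hε : 0 < ε) : ∃ r > 0, ∀ y z, |y| ≤ r → |z| ≤ r →
      |(f (x + y) - f x - b * y) - (f (x + z) - f x - b * z)| ≤ ε * |y - z| := by
  have h := hf.isLittleO.def hε
  rw [Metric.eventually_nhds_iff] at h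
  obtain ⟨r, hr, h⟩ := h
  refine ⟨r / 2, by positivity, fun y z hy hz => ?_⟩
  have := @h (x + y, x + z) (by
    rw [Prod.dist_eq, max_lt_iff, Real.dist_eq, Real.dist_eq]
    simp only [add_sub_cancel_left]
    constructor <;> linarith)
  simp only [Real.norm_eq_abs, add_sub_add_left_eq_sub] at this
  refine le_trans (le_of_eq ?_) this
  congr 1
  simp only [ContinuousLinearMap.toSpanSingleton_apply, smul_eq_mul]
  ring

theorem abs_max_min_le {r : ℝ} (hr : 0 ≤ r) (y : ℝ) : |max (-r) (min r y)| ≤ r :=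
  abs_le.2 ⟨le_max_left _ _, max_le (by linarith) (min_le_left _ _)⟩

theorem abs_max_min_sub_le (r y z : ℝ) :
    |max (-r) (min r y) - max (-r) (min r z)| ≤ |y - z| :=
  ((abs_max_sub_max_le_max _ _ _ _).trans (by simp)).trans
    (by simpa using abs_min_sub_min_le_max r y r z : |min r y - min r z| ≤ |y - z|)

theorem max_min_eq_self {r y : ℝ} (hy : |y| ≤ r) : max (-r) (min r y) = y := by
  rw [min_eq_right (abs_le.1 hy).2, max_eq_right (abs_le.1 hy).1]

/-- Existence and uniqueness of the stable extremal characteristic near `t = -∞`. -/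
theorem stable_characteristic
    (H : ℝ → ℝ) (hH : ContDiff ℝ 3 H)
    (xp a δ M T : ℝ)
    (hb : 0 < deriv (deriv H) xp)
    (ha : a < 0) (hδ0 : 0 < δ) (hδ : δ < -a / 2) (hM : 0 < M)
    (φ : ℝ → ℝ) (hφc : ContinuousOn φ (Set.Iic T))
    (hφ : ∀ t ≤ T, |φ t| ≤ M * Real.exp (-(2 * a + δ) * t)) :
    ∃ t₀ ≤ T, ∃ Y : ℝ → ℝ,
      IntEqPlus H xp a δ (deriv (deriv H) xp) φ Y t₀ ∧
      (∀ Z : ℝ → ℝ, IntEqPlus H xp a δ (deriv (deriv H) xp) φ Z t₀ →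
        ∀ t ≤ t₀, Z t = Y t) ∧
      (∀ t ≤ t₀, HasDerivWithinAt (fun u => xp + Y u)
        (-(deriv H (xp + Y t) - (deriv H xp + φ t))) (Set.Iic t₀) t) ∧
      Tendsto (fun t => (xp + Y t) - xp) atBot (𝓝 0) := by
  set b := deriv (deriv H) xp with hbdef
  have hH' : HasStrictDerivAt (deriv H) b xp := by
    have h2 : ContDiff ℝ 2 (deriv H) :=
      ((contDiff_succ_iff_deriv (n := 2)).1 (by exact_mod_cast hH)).2.2
    exact h2.hasStrictDerivAt (by norm_num)
  obtain ⟨r, hr, hrem⟩ := exists_remainder_lipschitz hH' (half_pos hb)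
  set ρ₀ : ℝ → ℝ := fun y => deriv H (xp + y) - deriv H xp - b * y with hρ₀
  set ρ : ℝ → ℝ := fun y => ρ₀ (max (-r) (min r y)) with hρdef
  have hρ_eq : ∀ y, |y| ≤ r → ρ y = ρ₀ y := fun y hy => by
    simp only [hρdef, max_min_eq_self hy]
  have hρ : ∀ y z, |ρ y - ρ z| ≤ b / 2 * |y - z| := fun y z =>
    (hrem _ _ (abs_max_min_le hr.le y) (abs_max_min_le hr.le z)).trans
      (mul_le_mul_of_nonneg_left (abs_max_min_sub_le r y z) (by positivity))
  have hρ0 : ρ 0 = 0 := by rw [hρ_eq 0 (by simpa using hr.le)]; simp [hρ₀]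
  have hρc : Continuous ρ := continuous_of_abs_sub_le (by positivity) hρ
  have hρ_abs : ∀ y, |ρ y| ≤ b / 2 * |y| := fun y => by simpa [hρ0] using hρ y 0
  set l := -a + δ with hl
  have hlpos : 0 < l := by linarith
  have hexp : ∀ c : ℝ, 0 < c → Tendsto (fun t => Real.exp (c * t)) atBot (𝓝 0) := fun c hc =>
    Real.tendsto_exp_atBot.comp (tendsto_id.const_mul_atBot hc)
  have hgap : 0 < -a - 2 * δ := by linarith
  obtain ⟨t₀, ht₀T, ht₀r, ht₀M⟩ : ∃ t₀ ≤ T, Real.exp (l * t₀) ≤ r ∧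
      M * Real.exp ((-a - 2 * δ) * t₀) ≤ b / 2 := by
    have h1 := (hexp l hlpos).eventually_le_const hr
    have h2 := ((hexp _ hgap).const_mul M).eventually_le_const
      (show M * 0 < b / 2 by rw [mul_zero]; positivity)
    obtain ⟨t, h⟩ := ((eventually_le_atBot T).and (h1.and h2)).exists
    exact ⟨t, h⟩
  have hφw : ∀ t ≤ t₀, |φ t| ≤ b / 2 * Real.exp (l * t) := fun t ht => by
    refine (hφ t (ht.trans ht₀T)).trans ?_
    rw [show -(2 * a + δ) * t = (-a - 2 * δ) * t + l * t by rw [hl]; ring, Real.exp_add,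
      ← mul_assoc]
    refine mul_le_mul_of_nonneg_right (le_trans ?_ ht₀M) (Real.exp_pos _).le
    gcongr
  have hw : ∀ {s t : ℝ}, s ≤ t → Real.exp (l * s) ≤ Real.exp (l * t) := fun h => by gcongr
  set ψ : ℝ → ℝ := fun t => φ (min t t₀) with hψdef
  have hψ : ∀ t ≤ t₀, ψ t = φ t := fun t ht => by simp only [hψdef, min_eq_left ht]
  have hψc : Continuous ψ :=
    hφc.comp_continuous (by fun_prop) fun t => (min_le_right t t₀).trans ht₀T
  have hψK : ∀ t, |ψ t| ≤ b / 2 * Real.exp (l * t₀) := fun t =>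
    (hφw _ (min_le_right t t₀)).trans
      (mul_le_mul_of_nonneg_left (hw (min_le_right t t₀)) (by positivity))
  obtain ⟨Y, hY⟩ := exists_eq_expConv hb hψc hψK hρ0 hρ
  have hYbd : ∀ t ≤ t₀, |Y t| ≤ Real.exp (l * t) := fun t ht => by
    have := abs_le_of_bound_improves (D := Y) (t := t) (A := Real.exp (l * t) / 2)
      (fun s _ => Y.norm_coe_le_norm s) fun C hC s hs => by
        rw [hY s]
        refine (abs_expConv_le (C := b / 2 * Real.exp (l * t) + b / 2 * C) hb
          fun u hu => ?_).trans (le_of_eq (by field_simp))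
        have hut := hu.trans hs
        refine (abs_sub _ _).trans (add_le_add ?_ ((hρ_abs _).trans ?_))
        · rw [hψ u (hut.trans ht)]
          exact (hφw u (hut.trans ht)).trans (mul_le_mul_of_nonneg_left (hw hut) (by positivity))
        · exact mul_le_mul_of_nonneg_left (hC u hut) (by positivity)
    linarith
  have hr_of : ∀ {y t : ℝ}, t ≤ t₀ → |y| ≤ Real.exp (l * t) → |y| ≤ r := fun ht hy =>
    (hy.trans (hw ht)).trans ht₀r
  have hYeq : ∀ t ≤ t₀, ψ t - ρ (Y t) = φ t - ρ₀ (Y t) := fun t ht => by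
    rw [hψ t ht, hρ_eq _ (hr_of ht (hYbd t ht))]
  have hρbd : ∀ y, |ρ y| ≤ b / 2 * r := fun y =>
    (by simpa [hρdef, hρ₀] using hrem _ 0 (abs_max_min_le hr.le y) (by simpa using hr.le) :
      |ρ y| ≤ b / 2 * |max (-r) (min r y)|).trans
      (mul_le_mul_of_nonneg_left (abs_max_min_le hr.le y) (by positivity))
  have hbd : ∀ (Z : ℝ → ℝ) s, |ψ s - ρ (Z s)| ≤ b / 2 * Real.exp (l * t₀) + b / 2 * r :=
    fun Z s => (abs_sub _ _).trans (add_le_add (hψK s) (hρbd _))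
  refine ⟨t₀, ht₀T, Y, ⟨Y.continuous.continuousOn, hYbd, fun t ht => ?_⟩, ?_, fun t ht => ?_, ?_⟩
  · rw [hY t]
    exact expConv_congr fun s hs => hYeq s (hs.trans ht)
  · rintro Z ⟨hZc, hZbd, hZ⟩ t ht
    set W : ℝ → ℝ := fun s => Z (min s t₀) with hWdef
    have hWZ : ∀ s ≤ t₀, W s = Z s := fun s hs => by simp only [hWdef, min_eq_left hs]
    have hWc : Continuous W := hZc.comp_continuous (by fun_prop) fun s => min_le_right s t₀
    have hW : ∀ s ≤ t₀, W s = expConv b (fun u => ψ u - ρ (W u)) s := fun s hs => by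
      rw [hWZ s hs, hZ s hs]
      refine expConv_congr fun u hu => ?_
      have hu₀ := hu.trans hs
      rw [hψ u hu₀, hWZ u hu₀, hρ_eq _ (hr_of hu₀ (hZbd u hu₀))]
    have h0 := abs_le_of_bound_improves (D := fun s => W s - Y s) (t := t) (A := 0)
      (C₀ := Real.exp (l * t₀) + Real.exp (l * t₀)) (fun s hs => by
        have hs₀ := hs.trans ht
        rw [hWZ s hs₀]
        exact (abs_sub _ _).trans (add_le_add ((hZbd s hs₀).trans (hw hs₀))
          ((hYbd s hs₀).trans (hw hs₀)))) fun C hC s hs => by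
        rw [hW s (hs.trans ht), hY s, expConv_sub hb (by fun_prop) (hbd W) (by fun_prop) (hbd Y)]
        refine (abs_expConv_le (C := b / 2 * C) hb fun u hu => ?_).trans
          (le_of_eq (by field_simp; ring))
        rw [show ψ u - ρ (W u) - (ψ u - ρ (Y u)) = -(ρ (W u) - ρ (Y u)) by ring, abs_neg]
        exact (hρ _ _).trans (mul_le_mul_of_nonneg_left (hC u (hu.trans hs)) (by positivity))
    rw [mul_zero] at h0
    rw [← hWZ t ht]
    exact sub_eq_zero.1 (abs_nonpos_iff.1 h0)
  · have hd := hasDerivAt_expConv hb (h := fun s => ψ s - ρ (Y s)) (by fun_prop) (hbd Y) t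
    rw [← funext hY, hYeq t ht] at hd
    refine ((hd.const_add xp).congr_deriv ?_).hasDerivWithinAt
    simp only [hρ₀]
    ring
  · simp only [add_sub_cancel_left]
    exact squeeze_zero_norm' ((eventually_le_atBot t₀).mono hYbd) (hexp l hlpos)
end

section
/- Let H : ℝ → ℝ be three times continuously differentiable, let x₀ ∈ ℝ with a := H''(x₀) < 0 and σ₀ := H'(x₀), let 0 < δ < −a/2, M > 0 and T ∈ ℝ, and let φ : (−∞,T] → ℝ be continuous with |φ(t)| ≤ M·e^{−(2a+δ)t} for all t ≤ T. Then for every K ∈ ℝ there exist t⋆ = t⋆(K) ≤ T and a constant C_K > 0 such that there is exactly one continuous function Y : (−∞,t⋆] → ℝ satisfying |Y(t)| ≤ C_K·e^{(−a+δ)t} for all t ≤ t⋆ and the integral equation Y(t) = ∫_{−∞}^t e^{−a(t−s)}·(φ(s) − ρ(s)) ds, where ρ(s) := H'(x₀ + K·e^{−as} + Y(s)) − σ₀ − a·(K·e^{−as} + Y(s)). Consequently X(t,K) := x₀ + K·e^{−at} + Y(t) is differentiable on (−∞,t⋆] and solves X'(t,K) = −(H'(X(t,K)) − (σ₀ + φ(t))).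 -/
open Set Filter MeasureTheory Topology

/-- Integral-equation formulation for the characteristic with asymptotic label `K`:
`Y` is continuous on `(-∞, t⋆]`, satisfies `|Y t| ≤ C·e^{(-a+δ)t}`, and solves
`Y t = ∫_{-∞}^t e^{-a(t-s)} (φ s - ρ s) ds`, where
`ρ s = H'(x₀ + K e^{-as} + Y s) - σ₀ - a (K e^{-as} + Y s)` with `σ₀ = H'(x₀)`. -/
def IntEqLabel (H : ℝ → ℝ) (x₀ a δ K C : ℝ) (φ Y : ℝ → ℝ) (tstar : ℝ) : Prop :=
  ContinuousOn Y (Set.Iic tstar) ∧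
  (∀ t ≤ tstar, |Y t| ≤ C * Real.exp ((-a + δ) * t)) ∧
  (∀ t ≤ tstar, Y t = ∫ s in Set.Iic t, Real.exp (-a * (t - s)) *
      (φ s - (deriv H (x₀ + K * Real.exp (-a * s) + Y s) - deriv H x₀
        - a * (K * Real.exp (-a * s) + Y s))))

theorem hasDerivWithinAt_integral_Iic {f : ℝ → ℝ} {τ : ℝ} (hf : ContinuousOn f (Iic τ))
    (hfi : IntegrableOn f (Iic τ)) {t : ℝ} (ht : t ≤ τ) :
    HasDerivWithinAt (fun u => ∫ s in Iic u, f s) (f t) (Iic τ) t := by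
  have hg : Continuous fun s => f (min s τ) :=
    hf.comp_continuous (by fun_prop) fun s => min_le_right s τ
  have hd : HasDerivAt (fun u => ∫ s in τ..u, f (min s τ)) (f (min t τ)) t :=
    intervalIntegral.integral_hasDerivAt_right (hg.intervalIntegrable _ _)
      hg.aestronglyMeasurable.stronglyMeasurableAtFilter hg.continuousAt
  rw [min_eq_left ht] at hd
  have hsplit : ∀ u ≤ τ, ∫ s in Iic u, f s = (∫ s in Iic τ, f s) + ∫ s in τ..u, f (min s τ) := by
    intro u hu
    have hcongr : ∫ s in τ..u, f (min s τ) = ∫ s in τ..u, f s := by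
      refine intervalIntegral.integral_congr fun s hs => ?_
      rw [uIcc_of_ge hu] at hs
      simp only [min_eq_left hs.2]
    rw [hcongr, ← intervalIntegral.integral_Iic_sub_Iic hfi (hfi.mono_set (Iic_subset_Iic.2 hu))]
    ring
  exact (hd.const_add (∫ s in Iic τ, f s)).hasDerivWithinAt.congr hsplit (hsplit t ht)

section ExponentialKernel

variable {h : ℝ → ℝ} {b η P τ : ℝ}

theorem abs_exp_mul_le_of_abs_le_exp (hb : ∀ s ≤ τ, |h s| ≤ P * Real.exp (η * s)) (t : ℝ) {s : ℝ}
    (hs : s ≤ τ) :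
    ‖Real.exp (b * (t - s)) * h s‖ ≤ P * Real.exp (b * t) * Real.exp ((η - b) * s) := by
  rw [Real.norm_eq_abs, abs_mul, Real.abs_exp]
  calc Real.exp (b * (t - s)) * |h s|
      ≤ Real.exp (b * (t - s)) * (P * Real.exp (η * s)) := by gcongr; exact hb s hs
    _ = P * (Real.exp (b * (t - s)) * Real.exp (η * s)) := by ring
    _ = P * Real.exp (b * t) * Real.exp ((η - b) * s) := by
      rw [mul_assoc, ← Real.exp_add, ← Real.exp_add]; ring_nf

theorem integrableOn_exp_mul_of_abs_le_exp (hη : b < η) (hc : ContinuousOn h (Iic τ))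
    (hb : ∀ s ≤ τ, |h s| ≤ P * Real.exp (η * s)) (t : ℝ) :
    IntegrableOn (fun s => Real.exp (b * (t - s)) * h s) (Iic τ) := by
  refine Integrable.mono' ((integrableOn_exp_mul_Iic (sub_pos.2 hη) τ).const_mul
    (P * Real.exp (b * t))) ?_ ?_
  · exact ContinuousOn.aestronglyMeasurable (by fun_prop) measurableSet_Iic
  · exact (ae_restrict_mem measurableSet_Iic).mono fun s hs => abs_exp_mul_le_of_abs_le_exp hb t hs

theorem abs_integral_exp_mul_le (hη : b < η)
    (hb : ∀ s ≤ τ, |h s| ≤ P * Real.exp (η * s)) {t : ℝ} (ht : t ≤ τ) :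
    |∫ s in Iic t, Real.exp (b * (t - s)) * h s| ≤ P / (η - b) * Real.exp (η * t) := by
  have key := norm_integral_le_of_norm_le
    ((integrableOn_exp_mul_Iic (sub_pos.2 hη) t).const_mul (P * Real.exp (b * t)))
    ((ae_restrict_mem measurableSet_Iic).mono fun s hs =>
      abs_exp_mul_le_of_abs_le_exp (b := b) hb t (le_trans hs ht))
  rw [Real.norm_eq_abs] at key
  refine key.trans_eq ?_
  rw [integral_const_mul, integral_exp_mul_Iic (sub_pos.2 hη)]
  have : Real.exp (η * t) = Real.exp (b * t) * Real.exp ((η - b) * t) := by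
    rw [← Real.exp_add]; ring_nf
  rw [this]; ring

theorem hasDerivWithinAt_integral_exp_mul (hη : b < η) (hc : ContinuousOn h (Iic τ))
    (hb : ∀ s ≤ τ, |h s| ≤ P * Real.exp (η * s)) {t : ℝ} (ht : t ≤ τ) :
    HasDerivWithinAt (fun u => ∫ s in Iic u, Real.exp (b * (u - s)) * h s)
      (b * (∫ s in Iic t, Real.exp (b * (t - s)) * h s) + h t) (Iic τ) t := by
  have hfac : ∀ u, ∫ s in Iic u, Real.exp (b * (u - s)) * h s =
      Real.exp (b * u) * ∫ s in Iic u, Real.exp (b * (0 - s)) * h s := by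
    intro u
    rw [← integral_const_mul]
    congr 1 with s
    rw [← mul_assoc, ← Real.exp_add]; ring_nf
  have hI := hasDerivWithinAt_integral_Iic (f := fun s => Real.exp (b * (0 - s)) * h s)
    (by fun_prop) (integrableOn_exp_mul_of_abs_le_exp hη hc hb 0) ht
  have hE : HasDerivAt (fun u => Real.exp (b * u)) (Real.exp (b * t) * b) t := by
    simpa using ((hasDerivAt_id t).const_mul b).exp
  refine ((hE.hasDerivWithinAt.mul hI).congr (fun u _ => hfac u) (hfac t)).congr_deriv ?_
  have hone : Real.exp (b * t) * Real.exp (b * (0 - t)) = 1 := by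
    rw [← Real.exp_add]; ring_nf; exact Real.exp_zero
  rw [hfac t]
  linear_combination h t * hone

end ExponentialKernel

/-- Lyapunov–Perron fixed point on a half-line, in the exponentially weighted unit ball. -/
theorem exists_unique_exp_weighted_solution {N : ℝ → ℝ → ℝ} {b η P q τ : ℝ} (hη : b < η)
    (hN : ContinuousOn (Function.uncurry N) (Iic τ ×ˢ univ))
    (hP : P ≤ η - b)
    (hNb : ∀ s ≤ τ, ∀ y, |y| ≤ Real.exp (η * s) → |N s y| ≤ P * Real.exp (η * s))
    (hq0 : 0 ≤ q) (hq : q < η - b)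
    (hNl : ∀ s ≤ τ, ∀ y z, |y| ≤ Real.exp (η * s) → |z| ≤ Real.exp (η * s) →
      |N s y - N s z| ≤ q * |y - z|) :
    ∃ Y : ℝ → ℝ, (ContinuousOn Y (Iic τ) ∧ (∀ t ≤ τ, |Y t| ≤ Real.exp (η * t)) ∧
        ∀ t ≤ τ, Y t = ∫ s in Iic t, Real.exp (b * (t - s)) * N s (Y s)) ∧
      ∀ Z : ℝ → ℝ, ContinuousOn Z (Iic τ) → (∀ t ≤ τ, |Z t| ≤ Real.exp (η * t)) →
        (∀ t ≤ τ, Z t = ∫ s in Iic t, Real.exp (b * (t - s)) * N s (Z s)) →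
        ∀ t ≤ τ, Z t = Y t := by
  have hηb : 0 < η - b := sub_pos.2 hη
  let clamp : ℝ → ℝ := fun x => projIcc (-1 : ℝ) 1 (by norm_num) x
  have clamp_cont : Continuous clamp := continuous_subtype_val.comp continuous_projIcc
  have clamp_abs : ∀ x, |clamp x| ≤ 1 := fun x => abs_le.2 (projIcc (-1 : ℝ) 1 _ x).2
  have clamp_of_abs : ∀ x, |x| ≤ 1 → clamp x = x := fun x hx => by
    simp only [clamp, projIcc_of_mem _ (abs_le.1 hx)]
  have clamp_lip : ∀ x y, |clamp x - clamp y| ≤ |x - y| := fun x y => by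
    simpa [Subtype.dist_eq, Real.dist_eq] using
      (LipschitzWith.projIcc (a := (-1 : ℝ)) (b := 1) (by norm_num)).dist_le_mul x y
  let y : (BoundedContinuousFunction ℝ ℝ) → ℝ → ℝ := fun W s => Real.exp (η * s) * clamp (W s)
  have y_cont : ∀ W, Continuous (y W) := fun W =>
    (by fun_prop : Continuous fun s => Real.exp (η * s)).mul (clamp_cont.comp W.continuous)
  have y_abs : ∀ W s, |y W s| ≤ Real.exp (η * s) := fun W s => by
    simp only [y, abs_mul, Real.abs_exp]
    exact mul_le_of_le_one_right (Real.exp_pos _).le (clamp_abs _)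
  have h_cont : ∀ W, ContinuousOn (fun s => N s (y W s)) (Iic τ) := fun W =>
    hN.comp (f := fun s => (s, y W s)) (continuous_id.prodMk (y_cont W)).continuousOn
      fun s hs => ⟨hs, mem_univ _⟩
  have h_abs : ∀ W, ∀ s ≤ τ, |N s (y W s)| ≤ P * Real.exp (η * s) :=
    fun W s hs => hNb s hs _ (y_abs W s)
  let J : (BoundedContinuousFunction ℝ ℝ) → ℝ → ℝ := fun W t =>
    ∫ s in Iic t, Real.exp (b * (t - s)) * N s (y W s)
  have J_cont : ∀ W, ContinuousOn (J W) (Iic τ) := fun W t ht =>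
    (hasDerivWithinAt_integral_exp_mul hη (h_cont W) (h_abs W) ht).continuousWithinAt
  have exp_cancel : ∀ t x, Real.exp (η * t) * (Real.exp (-η * t) * x) = x := fun t x => by
    rw [← mul_assoc, ← Real.exp_add]; ring_nf; simp
  have weight : ∀ {x R t : ℝ}, |x| ≤ R * Real.exp (η * t) → |Real.exp (-η * t) * x| ≤ R := by
    intro x R t hx
    rw [abs_mul, Real.abs_exp]
    refine (mul_le_mul_of_nonneg_left hx (Real.exp_pos _).le).trans_eq ?_
    rw [mul_left_comm, ← Real.exp_add]; ring_nf; simp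
  have min_cont : Continuous fun t : ℝ => min t τ := by fun_prop
  have extend : ∀ x : ℝ → ℝ, ContinuousOn x (Iic τ) →
      Continuous fun t => Real.exp (-η * min t τ) * x (min t τ) := fun x hx =>
    (by fun_prop : Continuous fun t => Real.exp (-η * min t τ)).mul
      (hx.comp_continuous min_cont fun t => min_le_right t τ)
  have PhiW_abs : ∀ W t, |Real.exp (-η * min t τ) * J W (min t τ)| ≤ P / (η - b) := fun W t =>
    weight (abs_integral_exp_mul_le hη (h_abs W) (min_le_right t τ))
  let Φ : (BoundedContinuousFunction ℝ ℝ) → (BoundedContinuousFunction ℝ ℝ) := fun W =>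
    BoundedContinuousFunction.ofNormedAddCommGroup
      (fun t => Real.exp (-η * min t τ) * J W (min t τ)) (extend _ (J_cont W)) (P / (η - b))
      (PhiW_abs W)
  have Phi_apply : ∀ W t, Φ W t = Real.exp (-η * min t τ) * J W (min t τ) := fun W t => rfl
  have hΦ : ContractingWith (NNReal.mk (q / (η - b)) (div_nonneg hq0 hηb.le)) Φ := by
    refine ⟨(div_lt_one hηb).2 hq, LipschitzWith.of_dist_le_mul fun W V => ?_⟩
    rw [NNReal.coe_mk,
      BoundedContinuousFunction.dist_le (mul_nonneg (div_nonneg hq0 hηb.le) dist_nonneg)]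
    intro t
    have hm := min_le_right t τ
    have hdiff : ∀ s ≤ τ, |N s (y W s) - N s (y V s)| ≤ q * dist W V * Real.exp (η * s) := by
      intro s hs
      refine (hNl s hs _ _ (y_abs W s) (y_abs V s)).trans ?_
      rw [mul_assoc]
      refine mul_le_mul_of_nonneg_left ?_ hq0
      simp only [y]
      rw [← mul_sub, abs_mul, Real.abs_exp, mul_comm]
      refine mul_le_mul_of_nonneg_right ?_ (Real.exp_pos _).le
      exact (clamp_lip _ _).trans
        ((Real.dist_eq (W s) (V s)).symm.trans_le (BoundedContinuousFunction.dist_coe_le_dist s))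
    have hsub : J W (min t τ) - J V (min t τ) = ∫ s in Iic (min t τ),
        Real.exp (b * (min t τ - s)) * (N s (y W s) - N s (y V s)) := by
      simp only [J, mul_sub (Real.exp _)]
      exact (integral_sub
        ((integrableOn_exp_mul_of_abs_le_exp hη (h_cont W) (h_abs W) _).mono_set
          (Iic_subset_Iic.2 hm))
        ((integrableOn_exp_mul_of_abs_le_exp hη (h_cont V) (h_abs V) _).mono_set
          (Iic_subset_Iic.2 hm))).symm
    rw [Real.dist_eq, Phi_apply, Phi_apply, ← mul_sub, hsub, div_mul_eq_mul_div]
    exact weight (abs_integral_exp_mul_le hη hdiff hm)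
  let W := ContractingWith.fixedPoint Φ hΦ
  have hW : Φ W = W := hΦ.fixedPoint_isFixedPt
  have hW1 : ∀ t, |W t| ≤ 1 := fun t => by
    rw [← hW]
    exact (PhiW_abs W t).trans ((div_le_one hηb).2 hP)
  have hy : ∀ s, y W s = Real.exp (η * s) * W s := fun s => by
    simp only [y, clamp_of_abs _ (hW1 s)]
  refine ⟨y W, ⟨(y_cont W).continuousOn, fun t _ => y_abs W t, fun t ht => ?_⟩, ?_⟩
  · rw [hy, ← hW, Phi_apply, min_eq_left ht, exp_cancel, hW]
  · intro Z hZc hZb hZe t ht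
    have hZ1 : ∀ t, |Real.exp (-η * min t τ) * Z (min t τ)| ≤ 1 := fun t =>
      weight (by simpa using hZb _ (min_le_right t τ))
    let V : BoundedContinuousFunction ℝ ℝ := BoundedContinuousFunction.ofNormedAddCommGroup
      (fun t => Real.exp (-η * min t τ) * Z (min t τ)) (extend _ hZc) 1 hZ1
    have V_apply : ∀ t, V t = Real.exp (-η * min t τ) * Z (min t τ) := fun t => rfl
    have hyV : ∀ s ≤ τ, y V s = Z s := fun s hs => by
      simp only [y]
      rw [V_apply, clamp_of_abs _ (hZ1 s), min_eq_left hs, exp_cancel]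
    have hV : Function.IsFixedPt Φ V := by
      ext t
      rw [Phi_apply, V_apply, hZe _ (min_le_right t τ)]
      congr 1
      refine setIntegral_congr_fun measurableSet_Iic fun s hs => ?_
      simp only [hyV s (le_trans hs (min_le_right t τ))]
    rw [← hyV t ht, hΦ.fixedPoint_unique hV]

/-- A `C²` function on `ℝ` minus its affine part at `x₀` has Lipschitz constant `O(r)` on the
ball of radius `r`. -/
theorem exists_abs_linearization_error_sub_le {g : ℝ → ℝ} (hg : ContDiff ℝ 2 g) (x₀ : ℝ) :
    ∃ L > 0, ∀ r ≤ 1, ∀ u v, |u| ≤ r → |v| ≤ r →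
      |(g (x₀ + u) - deriv g x₀ * u) - (g (x₀ + v) - deriv g x₀ * v)| ≤ L * r * |u - v| := by
  have hg1 : ContDiff ℝ 1 (deriv g) := hg.deriv' (n := 1)
  obtain ⟨B, hB⟩ := (isCompact_Icc (a := x₀ - 1) (b := x₀ + 1)).exists_bound_of_continuousOn
    (hg1.continuous_deriv le_rfl).continuousOn
  refine ⟨max B 1, by positivity, fun r hr u v hu hv => ?_⟩
  have hslope : ∀ w, |w| ≤ r → |deriv g (x₀ + w) - deriv g x₀| ≤ max B 1 * r := by
    intro w hw
    have hw' := abs_le.1 (hw.trans hr)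
    have := (convex_Icc (x₀ - 1) (x₀ + 1)).norm_image_sub_le_of_norm_deriv_le
      (fun x _ => hg1.differentiable one_ne_zero x) (fun x hx => (hB x hx).trans (le_max_left B 1))
      (x := x₀) (y := x₀ + w) (by constructor <;> linarith) (by constructor <;> linarith)
    rw [Real.norm_eq_abs, Real.norm_eq_abs, add_sub_cancel_left] at this
    exact this.trans (by gcongr)
  have hd : ∀ w, HasDerivAt (fun w => g (x₀ + w) - deriv g x₀ * w)
      (deriv g (x₀ + w) - deriv g x₀) w := by
    intro w
    have h1 := (hg.differentiable two_ne_zero (x₀ + w)).hasDerivAt.comp_const_add x₀ w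
    have h2 := (hasDerivAt_id w).const_mul (deriv g x₀)
    exact (h1.sub h2).congr_deriv (by simp)
  exact (convex_Icc (-r) r).norm_image_sub_le_of_norm_hasDerivWithin_le
    (fun w _ => (hd w).hasDerivWithinAt) (fun w hw => hslope w (abs_le.2 hw))
    (abs_le.1 hv) (abs_le.1 hu)

/-- Existence and uniqueness of the characteristic curve emanating from the unstable
state `x₀` with asymptotic label `K`. -/
theorem unstable_characteristic
    (H : ℝ → ℝ) (hH : ContDiff ℝ 3 H)
    (x₀ a δ M T : ℝ)
    (ha : a = deriv (deriv H) x₀) (haneg : a < 0)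
    (hδ0 : 0 < δ) (hδ : δ < -a / 2) (hM : 0 < M)
    (φ : ℝ → ℝ) (hφc : ContinuousOn φ (Set.Iic T))
    (hφ : ∀ t ≤ T, |φ t| ≤ M * Real.exp (-(2 * a + δ) * t)) :
    ∀ K : ℝ, ∃ tstar ≤ T, ∃ C > 0, ∃ Y : ℝ → ℝ,
      IntEqLabel H x₀ a δ K C φ Y tstar ∧
      (∀ Z : ℝ → ℝ, IntEqLabel H x₀ a δ K C φ Z tstar →
        ∀ t ≤ tstar, Z t = Y t) ∧
      (∀ t ≤ tstar, HasDerivWithinAt (fun u => x₀ + K * Real.exp (-a * u) + Y u)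
        (-(deriv H (x₀ + K * Real.exp (-a * t) + Y t) - (deriv H x₀ + φ t)))
        (Set.Iic tstar) t) := by

  intro K
  obtain ⟨L, hL, hlin⟩ := exists_abs_linearization_error_sub_le
    (hH.deriv' (n := 2)) x₀
  rw [← ha] at hlin
  set R := |K| + 1 with hR
  have hRpos : 0 < R := by positivity
  have hexp : ∀ c : ℝ, 0 < c → Tendsto (fun t => Real.exp (c * t)) atBot (𝓝 0) := fun c hc =>
    Real.tendsto_exp_atBot.comp (tendsto_id.const_mul_atBot hc)
  have hev1 : ∀ᶠ t in atBot, R * Real.exp (-a * t) < 1 := by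
    have := (hexp (-a) (by linarith)).const_mul R
    rw [mul_zero] at this
    exact this.eventually_lt_const one_pos
  have hev2 : ∀ᶠ t in atBot, L * R * Real.exp (-a * t) < δ := by
    have := (hexp (-a) (by linarith)).const_mul (L * R)
    rw [mul_zero] at this
    exact this.eventually_lt_const hδ0
  have hev3 : ∀ᶠ t in atBot,
      M * Real.exp ((-a - 2 * δ) * t) + L * R ^ 2 * Real.exp ((-a - δ) * t) < δ := by
    have := ((hexp (-a - 2 * δ) (by linarith)).const_mul M).add
      ((hexp (-a - δ) (by linarith)).const_mul (L * R ^ 2))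
    rw [mul_zero, mul_zero, add_zero] at this
    exact this.eventually_lt_const hδ0
  obtain ⟨τ, h1, h2, h3, hτT, hτ0⟩ := (hev1.and (hev2.and (hev3.and
    ((eventually_le_atBot T).and (eventually_le_atBot 0))))).exists
  have hmono : ∀ c : ℝ, 0 < c → ∀ s ≤ τ, Real.exp (c * s) ≤ Real.exp (c * τ) :=
    fun c hc s hs => Real.exp_le_exp.2 (by gcongr)
  set N : ℝ → ℝ → ℝ := fun s y => φ s - (deriv H (x₀ + K * Real.exp (-a * s) + y) - deriv H x₀
        - a * (K * Real.exp (-a * s) + y)) with hN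
  have hHc : Continuous (deriv H) := hH.continuous_deriv (by norm_num)
  have hNc : ContinuousOn (Function.uncurry N) (Iic τ ×ˢ univ) := by
    have hφ1 : ContinuousOn (fun p : ℝ × ℝ => φ p.1) (Iic τ ×ˢ univ) :=
      hφc.comp continuousOn_fst fun p hp => le_trans hp.1 hτT
    exact hφ1.sub (Continuous.continuousOn (by fun_prop))
  have hr1 : ∀ s ≤ τ, R * Real.exp (-a * s) ≤ 1 := fun s hs =>
    (mul_le_mul_of_nonneg_left (hmono (-a) (by linarith) s hs) hRpos.le).trans h1.le
  have hur : ∀ s ≤ τ, ∀ y, |y| ≤ Real.exp ((-a + δ) * s) →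
      |K * Real.exp (-a * s) + y| ≤ R * Real.exp (-a * s) := by
    intro s hs y hy
    have hle : Real.exp ((-a + δ) * s) ≤ Real.exp (-a * s) :=
      Real.exp_le_exp.2 (by nlinarith)
    calc |K * Real.exp (-a * s) + y| ≤ |K * Real.exp (-a * s)| + |y| := abs_add_le _ _
      _ ≤ |K| * Real.exp (-a * s) + Real.exp (-a * s) := by
        rw [abs_mul, Real.abs_exp]; linarith
      _ = R * Real.exp (-a * s) := by rw [hR]; ring
  have hNb : ∀ s ≤ τ, ∀ y, |y| ≤ Real.exp ((-a + δ) * s) →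
      |N s y| ≤ δ * Real.exp ((-a + δ) * s) := by
    intro s hs y hy
    have hu := hur s hs y hy
    have hrem := hlin _ (hr1 s hs) _ 0 hu (by rw [abs_zero]; positivity)
    rw [sub_zero, add_zero, mul_zero, sub_zero] at hrem
    have hquad : |deriv H (x₀ + (K * Real.exp (-a * s) + y)) - a * (K * Real.exp (-a * s) + y)
        - deriv H x₀| ≤ L * R ^ 2 * (Real.exp (-a * s) * Real.exp (-a * s)) :=
      (hrem.trans (mul_le_mul_of_nonneg_left hu (by positivity))).trans_eq (by ring)
    have e1 : Real.exp (-a * s) * Real.exp (-a * s) =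
        Real.exp ((-a - δ) * s) * Real.exp ((-a + δ) * s) := by
      rw [← Real.exp_add, ← Real.exp_add]; ring_nf
    have e2 : Real.exp (-(2 * a + δ) * s) =
        Real.exp ((-a - 2 * δ) * s) * Real.exp ((-a + δ) * s) := by
      rw [← Real.exp_add]; ring_nf
    have hsplit : N s y = φ s - (deriv H (x₀ + (K * Real.exp (-a * s) + y))
        - a * (K * Real.exp (-a * s) + y) - deriv H x₀) := by
      simp only [hN, add_assoc]; ring
    have hφs := hφ s (hs.trans hτT)
    rw [e1] at hquad
    rw [e2] at hφs
    calc |N s y| ≤ M * (Real.exp ((-a - 2 * δ) * s) * Real.exp ((-a + δ) * s)) +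
          L * R ^ 2 * (Real.exp ((-a - δ) * s) * Real.exp ((-a + δ) * s)) := by
            rw [hsplit]; exact (abs_sub _ _).trans (add_le_add hφs hquad)
      _ = (M * Real.exp ((-a - 2 * δ) * s) + L * R ^ 2 * Real.exp ((-a - δ) * s)) *
          Real.exp ((-a + δ) * s) := by ring
      _ ≤ (M * Real.exp ((-a - 2 * δ) * τ) + L * R ^ 2 * Real.exp ((-a - δ) * τ)) *
          Real.exp ((-a + δ) * s) := by
        have := hmono (-a - 2 * δ) (by linarith) s hs
        have := hmono (-a - δ) (by linarith) s hs
        gcongr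
      _ ≤ δ * Real.exp ((-a + δ) * s) := by gcongr
  have hNl : ∀ s ≤ τ, ∀ y z, |y| ≤ Real.exp ((-a + δ) * s) → |z| ≤ Real.exp ((-a + δ) * s) →
      |N s y - N s z| ≤ L * R * Real.exp (-a * τ) * |y - z| := by
    intro s hs y z hy hz
    have hlip := hlin _ (hr1 s hs) _ _ (hur s hs z hz) (hur s hs y hy)
    rw [add_sub_add_left_eq_sub, abs_sub_comm z y] at hlip
    have hsub : N s y - N s z =
        (deriv H (x₀ + (K * Real.exp (-a * s) + z)) - a * (K * Real.exp (-a * s) + z)) -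
        (deriv H (x₀ + (K * Real.exp (-a * s) + y)) - a * (K * Real.exp (-a * s) + y)) := by
      simp only [hN, add_assoc]; ring
    rw [hsub]
    refine hlip.trans (mul_le_mul_of_nonneg_right ?_ (abs_nonneg _))
    rw [mul_assoc L R]
    have := hmono (-a) (by linarith) s hs
    gcongr
  obtain ⟨Y, ⟨hYc, hYb, hYe⟩, hYu⟩ := exists_unique_exp_weighted_solution
    (b := -a) (η := -a + δ) (by linarith) hNc (by linarith) hNb (by positivity)
    (by linarith) hNl
  refine ⟨τ, hτT, 1, one_pos, Y, ⟨hYc, by simpa using hYb, hYe⟩, ?_, fun t ht => ?_⟩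
  · rintro Z ⟨hZc, hZb, hZe⟩
    exact hYu Z hZc (by simpa using hZb) hZe
  · have hc : ContinuousOn (fun s => N s (Y s)) (Iic τ) :=
      hNc.comp (continuousOn_id.prodMk hYc) fun s hs => ⟨hs, mem_univ _⟩
    have hY' := (hasDerivWithinAt_integral_exp_mul (b := -a) (by linarith) hc
      (fun s hs => hNb s hs _ (hYb s hs)) ht).congr hYe (hYe t ht)
    rw [← hYe t ht] at hY'
    have hE : HasDerivAt (fun u => x₀ + K * Real.exp (-a * u)) (K * (Real.exp (-a * t) * -a)) t := by
      simpa using ((((hasDerivAt_id t).const_mul (-a)).exp).const_mul K).const_add x₀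
    refine (hE.hasDerivWithinAt.add hY').congr_deriv ?_
    simp only [hN]
    ring
end

section
/- Let H : ℝ → ℝ be twice continuously differentiable, let A < B be real numbers, let ρ : ℝ × ℝ → ℝ be a nonnegative continuously differentiable function such that for every t, ρ(·,t) vanishes outside (A,B) and ∫_ℝ ρ(x,t) dx = 1, let σ(t) := ∫_ℝ H'(x)·ρ(x,t) dx, and suppose ρ satisfies ∂ₜρ(x,t) = ∂ₓ( (H'(x) − σ(t))·ρ(x,t) ) for all (x,t). Then the energy E(t) := ∫_ℝ H(x)·ρ(x,t) dx is differentiable with E'(t) = −( ∫_ℝ (H'(x))²·ρ(x,t) dx − ( ∫_ℝ H'(x)·ρ(x,t) dx )² ) ≤ 0; in particular E is nonincreasing in t. -/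
open Set MeasureTheory

/-- A continuous function on the line vanishing outside a bounded interval is integrable. -/
lemma Continuous.integrable_of_eq_zero_off_Ioo {f : ℝ → ℝ} {a b : ℝ} (hf : Continuous f)
    (h0 : ∀ x, x ∉ Ioo a b → f x = 0) : Integrable f :=
  hf.integrable_of_hasCompactSupport <|
    HasCompactSupport.intro isCompact_Icc fun x hx => h0 x fun h => hx (Ioo_subset_Icc_self h)

/-- Differentiation under the integral sign for a family of functions supported in a fixed bounded
interval, whose parameter derivative is jointly continuous. -/
lemma hasDerivAt_integral_of_eq_zero_off_Ioo {f f' : ℝ → ℝ → ℝ} {a b : ℝ}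
    (hf : ∀ t, Continuous fun x => f x t) (hf' : Continuous fun p : ℝ × ℝ => f' p.1 p.2)
    (hderiv : ∀ x t, HasDerivAt (f x) (f' x t) t)
    (h0 : ∀ t x, x ∉ Ioo a b → f x t = 0) (t : ℝ) :
    HasDerivAt (fun τ => ∫ x, f x τ) (∫ x, f' x t) t := by
  have h0' : ∀ x s, x ∉ Ioo a b → f' x s = 0 := by
    intro x s hx
    have hzero : f x = fun _ => 0 := funext fun τ => h0 τ x hx
    have h := hderiv x s
    rw [hzero] at h
    exact h.unique (hasDerivAt_const s 0)
  obtain ⟨C, hC⟩ := (isCompact_Icc.prod isCompact_Icc : IsCompact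
    (Icc a b ×ˢ Icc (t - 1) (t + 1))).exists_bound_of_continuousOn hf'.continuousOn
  refine (hasDerivAt_integral_of_dominated_loc_of_deriv_le (F := fun τ x => f x τ)
    (F' := fun τ x => f' x τ) (bound := (Icc a b).indicator fun _ => C)
    (Icc_mem_nhds (by linarith : t - 1 < t) (by linarith : t < t + 1))
    (.of_forall fun τ => (hf τ).aestronglyMeasurable)
    ((hf t).integrable_of_eq_zero_off_Ioo (h0 t))
    (hf'.comp (by fun_prop : Continuous fun x : ℝ => (x, t))).aestronglyMeasurable
    (.of_forall fun x τ hτ => ?_) ?_ (.of_forall fun x τ _ => hderiv x τ)).2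
  · by_cases hx : x ∈ Icc a b
    · rw [indicator_of_mem hx]
      exact hC (x, τ) ⟨hx, hτ⟩
    · rw [indicator_of_notMem hx, h0' x τ fun h => hx (Ioo_subset_Icc_self h), norm_zero]
  · exact (integrable_indicator_iff measurableSet_Icc).2
      (integrableOn_const isCompact_Icc.measure_lt_top.ne)

/-- Integration by parts on the line against a `C¹` function vanishing outside a bounded
interval. -/
lemma integral_mul_deriv_eq_neg_of_eq_zero_off_Ioo {u g : ℝ → ℝ} {a b : ℝ}
    (hu : ContDiff ℝ 1 u) (hg : ContDiff ℝ 1 g) (h0 : ∀ x, x ∉ Ioo a b → g x = 0) :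
    ∫ x, u x * deriv g x = -∫ x, deriv u x * g x := by
  have hsupp : HasCompactSupport g :=
    HasCompactSupport.intro isCompact_Icc fun x hx => h0 x fun h => hx (Ioo_subset_Icc_self h)
  have hg' := hg.continuous_deriv le_rfl
  have hu' := hu.continuous_deriv le_rfl
  exact integral_mul_deriv_eq_deriv_mul_of_integrable
    (fun x _ => (hu.differentiable one_ne_zero x).hasDerivAt)
    (fun x _ => (hg.differentiable one_ne_zero x).hasDerivAt)
    ((hu.continuous.mul hg').integrable_of_hasCompactSupport hsupp.deriv.mul_left)
    ((hu'.mul hg.continuous).integrable_of_hasCompactSupport hsupp.mul_left)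
    ((hu.continuous.mul hg.continuous).integrable_of_hasCompactSupport hsupp.mul_left)

/-- Energy dissipation: for a classical compactly supported probability-density solution of
`∂ₜρ = ∂ₓ((H' - σ(t)) ρ)` with `σ(t) = ∫ H' ρ dx`, the energy `E(t) = ∫ H ρ dx` is
differentiable with `E' = -(∫ (H')² ρ - (∫ H' ρ)²) ≤ 0`; in particular `E` is nonincreasing. -/
theorem energy_decreasing
    (H : ℝ → ℝ) (hH : ContDiff ℝ 2 H)
    (A B : ℝ) (hAB : A < B)
    (ρ : ℝ → ℝ → ℝ)
    (hρC1 : ContDiff ℝ 1 fun p : ℝ × ℝ => ρ p.1 p.2)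
    (hρ0 : ∀ x t, 0 ≤ ρ x t)
    (hsupp : ∀ t x, x ∉ Set.Ioo A B → ρ x t = 0)
    (hmass : ∀ t, (∫ x, ρ x t) = 1)
    (σ : ℝ → ℝ) (hσ : ∀ t, σ t = ∫ x, deriv H x * ρ x t)
    (hpde : ∀ x t, HasDerivAt (fun τ => ρ x τ)
      (deriv (fun y => (deriv H y - σ t) * ρ y t) x) t) :
    (∀ t, HasDerivAt (fun τ => ∫ x, H x * ρ x τ)
      (-((∫ x, (deriv H x) ^ 2 * ρ x t) - (∫ x, deriv H x * ρ x t) ^ 2)) t ∧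
      -((∫ x, (deriv H x) ^ 2 * ρ x t) - (∫ x, deriv H x * ρ x t) ^ 2) ≤ 0) ∧
    Antitone fun t => ∫ x, H x * ρ x t := by
  have hH' : ContDiff ℝ 1 (deriv H) := hH.deriv' (n := 1)
  have hcH' := hH'.continuous
  have hslice : ∀ t, ContDiff ℝ 1 fun x => ρ x t := fun t =>
    hρC1.comp (contDiff_id.prodMk contDiff_const)
  have hint : ∀ (w : ℝ → ℝ) (t : ℝ), Continuous w → Integrable fun x => w x * ρ x t :=
    fun w t hw => (hw.mul (hslice t).continuous).integrable_of_eq_zero_off_Ioo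
      (a := A) (b := B) fun x hx => by simp [hsupp t x hx]
  have hint_sq : ∀ t, Integrable fun x => deriv H x ^ 2 * ρ x t := fun t =>
    hint _ t (hcH'.pow 2)
  have hint_mul : ∀ c t, Integrable fun x => c * (deriv H x * ρ x t) := fun c t =>
    (hint _ t hcH').const_mul c
  have hderiv : ∀ t, HasDerivAt (fun τ => ∫ x, H x * ρ x τ)
      (-((∫ x, (deriv H x) ^ 2 * ρ x t) - (∫ x, deriv H x * ρ x t) ^ 2)) t := by
    intro t
    have hpartial : ∀ x τ, HasDerivAt (fun s => ρ x s)
        (fderiv ℝ (fun p : ℝ × ℝ => ρ p.1 p.2) (x, τ) (0, 1)) τ := fun x τ =>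
      (hρC1.differentiable one_ne_zero (x, τ)).hasFDerivAt.comp_hasDerivAt τ
        ((hasDerivAt_const τ x).prodMk (hasDerivAt_id τ))
    have hE := hasDerivAt_integral_of_eq_zero_off_Ioo (a := A) (b := B)
      (f := fun x τ => H x * ρ x τ)
      (f' := fun x τ => H x * fderiv ℝ (fun p : ℝ × ℝ => ρ p.1 p.2) (x, τ) (0, 1))
      (fun τ => hH.continuous.mul (hslice τ).continuous)
      ((hH.continuous.comp continuous_fst).mul
        ((hρC1.continuous_fderiv one_ne_zero).clm_apply continuous_const))
      (fun x τ => (hpartial x τ).const_mul (H x))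
      (fun τ x hx => by simp [hsupp τ x hx]) t
    refine hE.congr_deriv ?_
    simp_rw [fun x => (hpartial x t).unique (hpde x t)]
    rw [integral_mul_deriv_eq_neg_of_eq_zero_off_Ioo (a := A) (b := B) (hH.of_le one_le_two)
      ((hH'.sub contDiff_const).mul (hslice t)) fun x hx => by simp [hsupp t x hx]]
    have hsplit : ∀ x, deriv H x * ((deriv H x - σ t) * ρ x t) =
        deriv H x ^ 2 * ρ x t - σ t * (deriv H x * ρ x t) := fun x => by ring
    simp_rw [hsplit]
    rw [integral_sub (hint_sq t) (hint_mul _ t),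
      integral_const_mul, hσ t]
    ring
  have hnonpos : ∀ t,
      -((∫ x, (deriv H x) ^ 2 * ρ x t) - (∫ x, deriv H x * ρ x t) ^ 2) ≤ 0 := by
    intro t
    have hvar : 0 ≤ ∫ x, (deriv H x - σ t) ^ 2 * ρ x t :=
      integral_nonneg fun x => mul_nonneg (sq_nonneg _) (hρ0 x t)
    have hsplit : ∀ x, (deriv H x - σ t) ^ 2 * ρ x t =
        deriv H x ^ 2 * ρ x t - 2 * σ t * (deriv H x * ρ x t) + σ t ^ 2 * ρ x t :=
      fun x => by ring
    simp_rw [hsplit] at hvar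
    rw [integral_add (by exact (hint_sq t).sub (hint_mul _ t)) (hint _ t continuous_const),
      integral_sub (hint_sq t) (hint_mul _ t),
      integral_const_mul, integral_const_mul, hmass t, ← hσ t] at hvar
    rw [← hσ t]
    linarith
  exact ⟨fun t => ⟨hderiv t, hnonpos t⟩, antitone_of_hasDerivAt_nonpos hderiv hnonpos⟩
end

section
/- Let H : ℝ → ℝ be continuously differentiable, and let x⋆ < x⁺ be real numbers such that H' is strictly monotone on each of the three intervals (−∞, x⋆], [x⋆, x⁺], and [x⁺, ∞). Let μ be a Borel probability measure on ℝ with compact support such that ∫ (H'(x))² dμ(x) = ( ∫ H'(x) dμ(x) )². Then, with k := ∫ H' dμ, the level set (H')⁻¹({k}) contains at most three points, μ gives full mass to this level set, and consequently μ is a convex combination of at most three Dirac masses δ_{x₋}, δ_{x₀}, δ_{x₊}, at points satisfying H'(x₋) = H'(x₀) = H'(x₊) = k. -/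
open Set MeasureTheory ENNReal

theorem Set.InjOn.exists_eq_of_mem_of_eq {f : ℝ → ℝ} {S : Set ℝ} (hf : InjOn f S) {k y : ℝ}
    (hy : f y = k) : ∃ t, f t = k ∧ ∀ x ∈ S, f x = k → x = t := by
  by_cases h : ∃ t ∈ S, f t = k
  · obtain ⟨t, htS, ht⟩ := h
    exact ⟨t, ht, fun x hx hxk => hf hx htS (hxk.trans ht.symm)⟩
  · exact ⟨y, hy, fun x hx hxk => (h ⟨x, hx, hxk⟩).elim⟩

theorem injOn_of_strictMonoOn_or_strictAntiOn {f : ℝ → ℝ} {S : Set ℝ}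
    (h : StrictMonoOn f S ∨ StrictAntiOn f S) : InjOn f S :=
  h.elim StrictMonoOn.injOn StrictAntiOn.injOn

/-- A measure under which almost every point equals `t` is a multiple of the Dirac mass at `t`. -/
theorem MeasureTheory.Measure.eq_smul_dirac_of_ae_eq {α : Type*} [MeasurableSpace α]
    {ν : Measure α} {t : α} (h : ∀ᵐ x ∂ν, x = t) : ν = ν univ • Measure.dirac t := by
  have h' : (id : α → α) =ᵐ[ν] fun _ => t := h
  conv_lhs => rw [← Measure.map_id (μ := ν), Measure.map_congr h', Measure.map_const]

/-- A continuous function is square integrable for a finite measure carried by a compact set. -/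
theorem Continuous.memLp_two_of_measure_compl_eq_zero {f : ℝ → ℝ} (hf : Continuous f)
    {μ : Measure ℝ} [IsFiniteMeasure μ] {K : Set ℝ} (hK : IsCompact K) (hμ : μ Kᶜ = 0) :
    MemLp f 2 μ := by
  obtain ⟨C, hC⟩ := hK.exists_bound_of_continuousOn hf.continuousOn
  refine MemLp.of_bound hf.aestronglyMeasurable C ?_
  filter_upwards [measure_eq_zero_iff_ae_notMem.mp hμ] with x hx
  exact hC x (not_not.mp hx)

/-- A square integrable function with vanishing variance is almost surely equal to its mean. -/
theorem MeasureTheory.MemLp.ae_eq_integral_of_integral_sq_eq {α : Type*} [MeasurableSpace α]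
    {μ : Measure α} [IsProbabilityMeasure μ] {f : α → ℝ} (hf : MemLp f 2 μ)
    (h : ∫ x, f x ^ 2 ∂μ = (∫ x, f x ∂μ) ^ 2) : ∀ᵐ x ∂μ, f x = ∫ x, f x ∂μ := by
  have hvar : ProbabilityTheory.variance f μ = 0 := by
    rw [ProbabilityTheory.variance_eq_sub hf]
    simpa [sub_eq_zero] using h
  have hint : Integrable (fun x => (f x - ∫ y, f y ∂μ) ^ 2) μ :=
    (hf.sub (memLp_const _)).integrable_sq
  rw [ProbabilityTheory.variance_eq_integral hf.aestronglyMeasurable.aemeasurable,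
    integral_eq_zero_iff_of_nonneg (fun _ => sq_nonneg _) hint] at hvar
  filter_upwards [hvar] with x hx
  exact sub_eq_zero.mp (pow_eq_zero_iff two_ne_zero |>.mp hx)

/-- A measure on `ℝ` splits into its restrictions to the three intervals cut out by `a ≤ b`. -/
theorem MeasureTheory.Measure.eq_restrict_Iic_add_Ioc_add_Ioi (μ : Measure ℝ) {a b : ℝ}
    (hab : a ≤ b) :
    μ = μ.restrict (Iic a) + μ.restrict (Ioc a b) + μ.restrict (Ioi b) := by
  rw [← Measure.restrict_union (Iic_disjoint_Ioc le_rfl) measurableSet_Ioc,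
    Iic_union_Ioc_eq_Iic hab,
    ← Measure.restrict_union (Iic_disjoint_Ioi le_rfl) measurableSet_Ioi, Iic_union_Ioi,
    Measure.restrict_univ]

/-- If `H'` has three strictly monotone branches separated by `x⋆ < x⁺` and a compactly
supported probability measure `μ` has vanishing variance of `H'`, then with `k = ∫ H' dμ`
the level set `(H')⁻¹({k})` has at most three points, `μ` is concentrated on it, and `μ`
is a convex combination of at most three Dirac masses at points sharing the value `k` of `H'`. -/
theorem vanishing_variance_structure
    (H : ℝ → ℝ) (hH : ContDiff ℝ 1 H)
    (xstar xplus : ℝ) (hx : xstar < xplus)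
    (h₁ : StrictMonoOn (deriv H) (Set.Iic xstar) ∨ StrictAntiOn (deriv H) (Set.Iic xstar))
    (h₂ : StrictMonoOn (deriv H) (Set.Icc xstar xplus) ∨
      StrictAntiOn (deriv H) (Set.Icc xstar xplus))
    (h₃ : StrictMonoOn (deriv H) (Set.Ici xplus) ∨ StrictAntiOn (deriv H) (Set.Ici xplus))
    (μ : Measure ℝ) [IsProbabilityMeasure μ]
    (hcs : ∃ K : Set ℝ, IsCompact K ∧ μ Kᶜ = 0)
    (hvar : (∫ x, (deriv H x) ^ 2 ∂μ) = (∫ x, deriv H x ∂μ) ^ 2) :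
    (∃ s : Finset ℝ, (deriv H ⁻¹' {∫ x, deriv H x ∂μ}) ⊆ ↑s ∧ s.card ≤ 3) ∧
    μ ((deriv H ⁻¹' {∫ x, deriv H x ∂μ})ᶜ) = 0 ∧
    ∃ (xm x₀ xp : ℝ) (mm m₀ mp : ℝ≥0∞),
      mm + m₀ + mp = 1 ∧
      deriv H xm = (∫ x, deriv H x ∂μ) ∧
      deriv H x₀ = (∫ x, deriv H x ∂μ) ∧
      deriv H xp = (∫ x, deriv H x ∂μ) ∧
      μ = mm • Measure.dirac xm + m₀ • Measure.dirac x₀ + mp • Measure.dirac xp := by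
  obtain ⟨K, hK, hμK⟩ := hcs
  have hae : ∀ᵐ x ∂μ, deriv H x = ∫ x, deriv H x ∂μ :=
    ((hH.continuous_deriv le_rfl).memLp_two_of_measure_compl_eq_zero hK hμK
      ).ae_eq_integral_of_integral_sq_eq hvar
  obtain ⟨y, hy⟩ := hae.exists
  obtain ⟨a, ha, hSa⟩ := (injOn_of_strictMonoOn_or_strictAntiOn h₁).exists_eq_of_mem_of_eq hy
  obtain ⟨b, hb, hSb⟩ := (injOn_of_strictMonoOn_or_strictAntiOn h₂).exists_eq_of_mem_of_eq hy
  obtain ⟨c, hc, hSc⟩ := (injOn_of_strictMonoOn_or_strictAntiOn h₃).exists_eq_of_mem_of_eq hy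
  have hsum := μ.eq_restrict_Iic_add_Ioc_add_Ioi hx.le
  refine ⟨⟨{a, b, c}, fun x hxk => ?_, Finset.card_le_three⟩, hae, a, b, c, μ (Iic xstar),
    μ (Ioc xstar xplus), μ (Ioi xplus), ?_, ha, hb, hc, ?_⟩
  · simp only [Finset.coe_insert, Finset.coe_singleton, mem_insert_iff, mem_singleton_iff]
    rcases le_total x xstar with h | h
    · exact Or.inl (hSa x h hxk)
    · rcases le_total x xplus with h' | h'
      · exact Or.inr (Or.inl (hSb x ⟨h, h'⟩ hxk))
      · exact Or.inr (Or.inr (hSc x h' hxk))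
  · simpa using (congrArg (fun ν : Measure ℝ => ν univ) hsum).symm
  · have hrestrict : ∀ {S T : Set ℝ} {t : ℝ}, MeasurableSet S → S ⊆ T →
        (∀ x ∈ T, deriv H x = (∫ x, deriv H x ∂μ) → x = t) →
        μ.restrict S = μ S • Measure.dirac t := by
      intro S T t hS hST ht
      have h : ∀ᵐ x ∂μ.restrict S, x = t := by
        filter_upwards [ae_restrict_of_ae hae, ae_restrict_mem hS] with x hxk hxS
        exact ht x (hST hxS) hxk
      simpa using Measure.eq_smul_dirac_of_ae_eq h
    rw [← hrestrict measurableSet_Iic subset_rfl hSa,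
      ← hrestrict measurableSet_Ioc Ioc_subset_Icc_self hSb,
      ← hrestrict measurableSet_Ioi Ioi_subset_Ici_self hSc]
    exact hsum
end

section
/- Let a < 0 < b, m ∈ (0,1], δ > 0 with −a − δ > 0, M > 0 and t₀ ∈ ℝ. Define the operator 𝓛 on continuous functions φ : (−∞,t₀] → ℝ by (𝓛φ)(t) = φ(t) − m·a·∫_{−∞}^t e^{−a(t−z)}·φ(z) dz − (1−m)·b·∫_{−∞}^t e^{−b(t−z)}·φ(z) dz. Suppose (1−m)·a + m·b > 0. If φ : (−∞,t₀] → ℝ is continuous, satisfies |φ(t)| ≤ M·e^{−(2a+δ)t} for all t ≤ t₀ (so in particular φ(t) → 0 as t → −∞ and all the integrals converge absolutely), and (𝓛φ)(t) = 0 for every t ≤ t₀, then φ is identically zero on (−∞,t₀]. -/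
open Set MeasureTheory

open Filter Topology

lemma integrableOn_exp_mul_of_abs_le_exp_s16 {φ : ℝ → ℝ} {t₀ M ρ k : ℝ}
    (hφc : ContinuousOn φ (Iic t₀)) (hφ : ∀ t ≤ t₀, |φ t| ≤ M * Real.exp (ρ * t))
    (hk : 0 < k + ρ) : IntegrableOn (fun z => Real.exp (k * z) * φ z) (Iic t₀) := by
  refine ((integrableOn_exp_mul_Iic hk t₀).const_mul M).mono' ?_ ?_
  · have hc : ContinuousOn (fun z => Real.exp (k * z) * φ z) (Iic t₀) := by fun_prop
    exact hc.aestronglyMeasurable measurableSet_Iic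
  · filter_upwards [ae_restrict_mem measurableSet_Iic] with z hz
    rw [norm_mul, Real.norm_eq_abs, Real.norm_eq_abs, Real.abs_exp]
    calc Real.exp (k * z) * |φ z| ≤ Real.exp (k * z) * (M * Real.exp (ρ * z)) := by
          gcongr
          exact hφ z hz
      _ = M * Real.exp ((k + ρ) * z) := by rw [add_mul, Real.exp_add]; ring

lemma setIntegral_exp_neg_mul_sub (φ : ℝ → ℝ) (k t : ℝ) :
    ∫ z in Iic t, Real.exp (-k * (t - z)) * φ z
      = Real.exp (-k * t) * ∫ z in Iic t, Real.exp (k * z) * φ z := by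
  rw [← integral_const_mul]
  congr 1 with z
  rw [← mul_assoc, ← Real.exp_add]
  ring_nf

/-- The exponentially weighted history of `φ` solves `F' = -k F + φ`. -/
lemma hasDerivAt_setIntegral_exp_neg_mul_sub {φ : ℝ → ℝ} {t₀ M ρ k t : ℝ}
    (hφc : ContinuousOn φ (Iic t₀)) (hφ : ∀ t ≤ t₀, |φ t| ≤ M * Real.exp (ρ * t))
    (hk : 0 < k + ρ) (ht : t < t₀) :
    HasDerivAt (fun t => ∫ z in Iic t, Real.exp (-k * (t - z)) * φ z)
      (-k * (∫ z in Iic t, Real.exp (-k * (t - z)) * φ z) + φ t) t := by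
  have hint := integrableOn_exp_mul_of_abs_le_exp_s16 hφc hφ hk
  have hc : ContinuousOn (fun z => Real.exp (k * z) * φ z) (Iic t₀) := by fun_prop
  have hnear : Iic t₀ ∈ 𝓝 t := Iic_mem_nhds ht
  have hprim : HasDerivAt (fun s => ∫ z in Iic s, Real.exp (k * z) * φ z)
      (Real.exp (k * t) * φ t) t := by
    have hftc : HasDerivAt (fun s => ∫ z in t..s, Real.exp (k * z) * φ z)
        (Real.exp (k * t) * φ t) t :=
      intervalIntegral.integral_hasDerivAt_right IntervalIntegrable.refl
        ⟨Iic t₀, hnear, hc.aestronglyMeasurable measurableSet_Iic⟩ (hc.continuousAt hnear)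
    refine (hftc.const_add (∫ z in Iic t, Real.exp (k * z) * φ z)).congr_of_eventuallyEq ?_
    filter_upwards [hnear] with s hs
    rw [← intervalIntegral.integral_Iic_sub_Iic (hint.mono_set (Iic_subset_Iic.2 ht.le))
      (hint.mono_set (Iic_subset_Iic.2 hs))]
    ring
  have hexp : HasDerivAt (fun s => Real.exp (-k * s)) (Real.exp (-k * t) * -k) t := by
    simpa using ((hasDerivAt_id t).const_mul (-k)).exp
  simp_rw [setIntegral_exp_neg_mul_sub]
  refine (hexp.mul hprim).congr_deriv ?_
  have hone : Real.exp (-k * t) * Real.exp (k * t) = 1 := by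
    rw [← Real.exp_add]; simp
  linear_combination φ t * hone

lemma abs_setIntegral_exp_neg_mul_sub_le {φ : ℝ → ℝ} {t₀ M ρ k t : ℝ}
    (hφ : ∀ t ≤ t₀, |φ t| ≤ M * Real.exp (ρ * t)) (hk : 0 < k + ρ) (ht : t ≤ t₀) :
    |∫ z in Iic t, Real.exp (-k * (t - z)) * φ z| ≤ M / (k + ρ) * Real.exp (ρ * t) := by
  have hbound : ‖∫ z in Iic t, Real.exp (k * z) * φ z‖
      ≤ ∫ z in Iic t, M * Real.exp ((k + ρ) * z) := by
    refine norm_integral_le_of_norm_le ((integrableOn_exp_mul_Iic hk t).const_mul M) ?_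
    filter_upwards [ae_restrict_mem measurableSet_Iic] with z hz
    rw [norm_mul, Real.norm_eq_abs, Real.norm_eq_abs, Real.abs_exp]
    calc Real.exp (k * z) * |φ z| ≤ Real.exp (k * z) * (M * Real.exp (ρ * z)) := by
          gcongr
          exact hφ z (le_trans hz ht)
      _ = M * Real.exp ((k + ρ) * z) := by rw [add_mul, Real.exp_add]; ring
  rw [Real.norm_eq_abs, integral_const_mul, integral_exp_mul_Iic hk] at hbound
  rw [setIntegral_exp_neg_mul_sub, abs_mul, Real.abs_exp]
  calc Real.exp (-k * t) * |∫ z in Iic t, Real.exp (k * z) * φ z|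
      ≤ Real.exp (-k * t) * (M * (Real.exp ((k + ρ) * t) / (k + ρ))) := by gcongr
    _ = M / (k + ρ) * (Real.exp (-k * t) * Real.exp ((k + ρ) * t)) := by ring
    _ = M / (k + ρ) * Real.exp (ρ * t) := by
      rw [← Real.exp_add]; ring_nf

lemma tendsto_exp_mul_atBot {ρ : ℝ} (hρ : 0 < ρ) :
    Tendsto (fun t => Real.exp (ρ * t)) atBot (𝓝 0) :=
  Real.tendsto_exp_atBot.comp (tendsto_id.const_mul_atBot hρ)

lemma tendsto_setIntegral_exp_neg_mul_sub_atBot {φ : ℝ → ℝ} {t₀ M ρ k : ℝ}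
    (hφ : ∀ t ≤ t₀, |φ t| ≤ M * Real.exp (ρ * t)) (hk : 0 < k + ρ) (hρ : 0 < ρ) :
    Tendsto (fun t => ∫ z in Iic t, Real.exp (-k * (t - z)) * φ z) atBot (𝓝 0) := by
  have hlim : Tendsto (fun t => M / (k + ρ) * Real.exp (ρ * t)) atBot (𝓝 0) := by
    simpa using (tendsto_exp_mul_atBot hρ).const_mul (M / (k + ρ))
  refine squeeze_zero_norm' ?_ hlim
  filter_upwards [Iic_mem_atBot t₀] with t ht
  exact abs_setIntegral_exp_neg_mul_sub_le hφ hk ht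

lemma eq_zero_of_hasDerivAt_zero_of_tendsto_atBot {f : ℝ → ℝ} {t₀ : ℝ}
    (hf : ∀ t < t₀, HasDerivAt f 0 t) (hlim : Tendsto f atBot (𝓝 0)) {t : ℝ} (ht : t < t₀) :
    f t = 0 := by
  refine tendsto_nhds_unique (Tendsto.congr' ?_ tendsto_const_nhds) hlim
  filter_upwards [Iio_mem_atBot t₀] with s hs
  exact isOpen_Iio.is_const_of_deriv_eq_zero isPreconnected_Iio
    (fun x hx => (hf x hx).differentiableAt.differentiableWithinAt)
    (fun x hx => (hf x hx).deriv) ht hs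

/-- Injectivity (on the weighted space) of the linearized operator
`𝓛φ(t) = φ(t) - m a ∫_{-∞}^t e^{-a(t-z)} φ(z) dz - (1-m) b ∫_{-∞}^t e^{-b(t-z)} φ(z) dz`
under the stability condition `(1-m)a + mb > 0`: any continuous `φ` on `(-∞, t₀]` with
`|φ(t)| ≤ M e^{-(2a+δ)t}` and `𝓛φ ≡ 0` vanishes identically. -/
theorem linearized_operator_injective
    (a b m δ M t₀ : ℝ) (ha : a < 0) (hb : 0 < b)
    (hm : m ∈ Set.Ioc (0 : ℝ) 1) (hδ : 0 < δ) (hδ' : 0 < -a - δ) (hM : 0 < M)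
    (hstab : 0 < (1 - m) * a + m * b)
    (φ : ℝ → ℝ) (hφc : ContinuousOn φ (Set.Iic t₀))
    (hφ : ∀ t ≤ t₀, |φ t| ≤ M * Real.exp (-(2 * a + δ) * t))
    (hL : ∀ t ≤ t₀,
      φ t - m * a * (∫ z in Set.Iic t, Real.exp (-a * (t - z)) * φ z)
        - (1 - m) * b * (∫ z in Set.Iic t, Real.exp (-b * (t - z)) * φ z) = 0) :
    ∀ t ≤ t₀, φ t = 0 := by
  obtain ⟨U, hU⟩ : ∃ U : ℝ → ℝ,
      U = fun t => ∫ z in Iic t, Real.exp (-a * (t - z)) * φ z := ⟨_, rfl⟩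
  obtain ⟨V, hV⟩ : ∃ V : ℝ → ℝ,
      V = fun t => ∫ z in Iic t, Real.exp (-b * (t - z)) * φ z := ⟨_, rfl⟩
  have hρ : 0 < -(2 * a + δ) := by linarith
  have hka : 0 < a + -(2 * a + δ) := by linarith
  have hkb : 0 < b + -(2 * a + δ) := by linarith
  have hUV : ∀ t ≤ t₀, φ t = m * a * U t + (1 - m) * b * V t := fun t ht => by
    rw [hU, hV]
    linarith [hL t ht]
  have hU' : ∀ t < t₀, HasDerivAt U (-a * U t + φ t) t := fun t ht => by
    rw [hU]
    exact hasDerivAt_setIntegral_exp_neg_mul_sub hφc hφ hka ht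
  have hV' : ∀ t < t₀, HasDerivAt V (-b * V t + φ t) t := fun t ht => by
    rw [hV]
    exact hasDerivAt_setIntegral_exp_neg_mul_sub hφc hφ hkb ht
  have hU0 : Tendsto U atBot (𝓝 0) :=
    hU ▸ tendsto_setIntegral_exp_neg_mul_sub_atBot hφ hka hρ
  have hV0 : Tendsto V atBot (𝓝 0) :=
    hV ▸ tendsto_setIntegral_exp_neg_mul_sub_atBot hφ hkb hρ
  have hsum : ∀ t < t₀, m * U t + (1 - m) * V t = 0 := fun t ht => by
    refine eq_zero_of_hasDerivAt_zero_of_tendsto_atBot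
      (f := fun t => m * U t + (1 - m) * V t) (fun s hs => ?_) ?_ ht
    · refine (((hU' s hs).const_mul m).add ((hV' s hs).const_mul (1 - m))).congr_deriv ?_
      linear_combination hUV s hs.le
    · simpa using (hU0.const_mul m).add (hV0.const_mul (1 - m))
  have hdiff : ∀ t < t₀, a * U t - b * V t = 0 := fun t ht => by
    have hzero : Real.exp (((1 - m) * a + m * b) * t) * (a * U t - b * V t) = 0 := by
      refine eq_zero_of_hasDerivAt_zero_of_tendsto_atBot
        (f := fun t => Real.exp (((1 - m) * a + m * b) * t) * (a * U t - b * V t))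
        (fun s hs => ?_) ?_ ht
      · have hexp := ((hasDerivAt_id s).const_mul ((1 - m) * a + m * b)).exp
        refine (hexp.mul (((hU' s hs).const_mul a).sub ((hV' s hs).const_mul b))).congr_deriv ?_
        simp only [id_eq, Pi.sub_apply]
        rw [hUV s hs.le]
        ring
      · simpa using (tendsto_exp_mul_atBot hstab).mul ((hU0.const_mul a).sub (hV0.const_mul b))
    exact (mul_eq_zero.1 hzero).resolve_left (Real.exp_ne_zero _)
  have hφ0 : EqOn φ 0 (Iio t₀) := fun t ht => by
    have hVt : V t = 0 := by
      refine (mul_eq_zero.1 ?_).resolve_left hstab.ne'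
      linear_combination a * hsum t ht - m * hdiff t ht
    have hUt : U t = 0 := by
      refine (mul_eq_zero.1 ?_).resolve_left ha.ne
      linear_combination hdiff t ht + b * hVt
    simp [hUV t (le_of_lt ht), hUt, hVt]
  exact hφ0.of_subset_closure hφc continuousOn_const Iio_subset_Iic_self
    (closure_Iio' ⟨t₀ - 1, sub_one_lt t₀⟩).ge
end

section
/- Let a < 0 < b and m ∈ (0,1] with s := (1−m)·a + m·b > 0, and set θ₂ := −s < 0, c₁ := a·b/s, and c₂ := m·a + (1−m)·b − a·b/s. Define G_r : [0,∞) → ℝ by G_r(x) = c₁ + c₂·e^{θ₂·x}. Then for every x ≥ 0, G_r(x) − m·a·∫_0^x e^{−a(x−ζ)}·G_r(ζ) dζ − (1−m)·b·∫_0^x e^{−b(x−ζ)}·G_r(ζ) dζ = m·a·e^{−a·x} + (1−m)·b·e^{−b·x}. -/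
open Set MeasureTheory

/-- The convolution of `e^{-k x}` with `p + q e^{-s x}` on `[0, x]`, away from resonance. -/
theorem integral_exp_conv_add_exp {k s : ℝ} (hk : k ≠ 0) (hks : k - s ≠ 0) (p q x : ℝ) :
    ∫ ζ in (0 : ℝ)..x, Real.exp (-k * (x - ζ)) * (p + q * Real.exp (-s * ζ)) =
      p * (1 - Real.exp (-k * x)) / k
        + q * (Real.exp (-s * x) - Real.exp (-k * x)) / (k - s) := by
  have hderiv : ∀ ζ ∈ uIcc 0 x, HasDerivAt
      (fun ζ => p * Real.exp (-k * (x - ζ)) / k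
        + q * (Real.exp (-k * (x - ζ)) * Real.exp (-s * ζ)) / (k - s))
      (Real.exp (-k * (x - ζ)) * (p + q * Real.exp (-s * ζ))) ζ := by
    intro ζ _
    have h1 : HasDerivAt (fun ζ => Real.exp (-k * (x - ζ)))
        (Real.exp (-k * (x - ζ)) * (-k * -1)) ζ :=
      (((hasDerivAt_id ζ).const_sub x).const_mul (-k)).exp
    have h2 : HasDerivAt (fun ζ => Real.exp (-s * ζ)) (Real.exp (-s * ζ) * (-s * 1)) ζ :=
      ((hasDerivAt_id ζ).const_mul (-s)).exp
    refine (((h1.const_mul p).div_const k).add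
      (((h1.mul h2).const_mul q).div_const (k - s))).congr_deriv ?_
    field_simp
    ring
  rw [intervalIntegral.integral_eq_sub_of_hasDerivAt hderiv
    (Continuous.intervalIntegrable (by fun_prop) _ _)]
  simp only [sub_self, mul_zero, Real.exp_zero, sub_zero]
  ring

/-- The regular part `G_r(x) = c₁ + c₂ e^{θ₂ x}` of the Green's function of the linearized
operator satisfies, for every `x ≥ 0`,
`G_r(x) - m a ∫₀ˣ e^{-a(x-ζ)} G_r(ζ) dζ - (1-m) b ∫₀ˣ e^{-b(x-ζ)} G_r(ζ) dζ
  = m a e^{-a x} + (1-m) b e^{-b x}`,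
where `θ₂ = -s`, `c₁ = ab/s`, `c₂ = ma + (1-m)b - ab/s` and `s = (1-m)a + mb > 0`. -/
theorem green_function_identity
    (a b m : ℝ) (ha : a < 0) (hb : 0 < b) (hm : m ∈ Set.Ioc (0 : ℝ) 1)
    (hs : 0 < (1 - m) * a + m * b) :
    ∀ x : ℝ, 0 ≤ x →
      (a * b / ((1 - m) * a + m * b) +
          (m * a + (1 - m) * b - a * b / ((1 - m) * a + m * b)) *
            Real.exp (-((1 - m) * a + m * b) * x))
        - m * a * (∫ ζ in (0 : ℝ)..x, Real.exp (-a * (x - ζ)) *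
            (a * b / ((1 - m) * a + m * b) +
              (m * a + (1 - m) * b - a * b / ((1 - m) * a + m * b)) *
                Real.exp (-((1 - m) * a + m * b) * ζ)))
        - (1 - m) * b * (∫ ζ in (0 : ℝ)..x, Real.exp (-b * (x - ζ)) *
            (a * b / ((1 - m) * a + m * b) +
              (m * a + (1 - m) * b - a * b / ((1 - m) * a + m * b)) *
                Real.exp (-((1 - m) * a + m * b) * ζ)))
        = m * a * Real.exp (-a * x) + (1 - m) * b * Real.exp (-b * x) := by
  intro x _
  have hm0 : m ≠ 0 := hm.1.ne'
  have hab : a - b ≠ 0 := (by linarith : a - b < 0).ne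
  have ha0 : a ≠ 0 := ha.ne
  have hb0 : b ≠ 0 := hb.ne'
  have hs0 := hs.ne'
  have has : a - ((1 - m) * a + m * b) = m * (a - b) := by ring
  rw [integral_exp_conv_add_exp ha0 (has ▸ mul_ne_zero hm0 hab), has]
  rcases eq_or_ne m 1 with rfl | hm1
  · have : a * b / ((1 - 1) * a + 1 * b) = a := by
      rw [div_eq_iff hs0]
      ring
    rw [this]
    field_simp
    ring
  · have hm1' : 1 - m ≠ 0 := sub_ne_zero.2 hm1.symm
    have hbs : b - ((1 - m) * a + m * b) = -((1 - m) * (a - b)) := by ring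
    rw [integral_exp_conv_add_exp hb0 (hbs ▸ neg_ne_zero.2 (mul_ne_zero hm1' hab)), hbs]
    generalize Real.exp (-((1 - m) * a + m * b) * x) = E
    generalize Real.exp (-a * x) = A
    generalize Real.exp (-b * x) = B
    generalize hr : a * b / ((1 - m) * a + m * b) = r
    rw [div_eq_iff hs0] at hr
    field_simp
    linear_combination (A - B) * hr
end
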